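/- Let v^k be a sequence in H_𝔽 and v ∈ H_𝔽 such that v^k converges weakly to v, i.e. ⟨v^k, w⟩ → ⟨v, w⟩ for every w ∈ H_𝔽. Then, under assumptions (A1)–(A4) and for any x_0 ∈ ℝ and ϖ ∈ H_𝔽, the functional I is weakly lower semi-continuous: I[v] ≤ liminf_{k→∞} I[v^k]. -/

import Mathlib

/- STATEMENT 0: Weak lower semi-continuity of the cost functional I on H_𝔽
   under assumptions (A1)-(A4). -/

open MeasureTheory

noncomputable section

/-- Membership in the space `H_𝔽`: progressively measurable processes with
`E[∫_0^T v_t² dt] < ∞`. -/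
def MemH {Ω : Type*} {m : MeasurableSpace Ω} (P : Measure Ω) (T : ℝ)
    (𝔽 : Filtration ℝ m) (v : ℝ → Ω → ℝ) : Prop :=
  ProgMeasurable 𝔽 v ∧
    (∫⁻ ω, (∫⁻ t in Set.Ioc (0:ℝ) T, ENNReal.ofReal ((v t ω) ^ 2)) ∂P) < ⊤

/-- Inner product `⟨v,w⟩ = E[∫_0^T v_t w_t dt]` on `H_𝔽`. -/
def innerH {Ω : Type*} {_m : MeasurableSpace Ω} (P : Measure Ω) (T : ℝ)
    (v w : ℝ → Ω → ℝ) : ℝ :=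
  ∫ ω, (∫ t in Set.Ioc (0:ℝ) T, v t ω * w t ω) ∂P

/-- Trajectory `X_t = x₀ + ∫_0^t v_s ds`. -/
def traj {Ω : Type*} (x0 : ℝ) (v : ℝ → Ω → ℝ) (t : ℝ) (ω : Ω) : ℝ :=
  x0 + ∫ s in (0:ℝ)..t, v s ω

/-- Cost functional `I[v] = E[∫_0^T (L(X_t,v_t) + ϖ_t v_t) dt + Ψ(X_T)]`. -/
def cost {Ω : Type*} {_m : MeasurableSpace Ω} (P : Measure Ω) (T : ℝ)
    (L : ℝ → ℝ → ℝ) (Ψ : ℝ → ℝ) (ϖ : ℝ → Ω → ℝ) (x0 : ℝ) (v : ℝ → Ω → ℝ) : ℝ :=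
  ∫ ω, ((∫ t in Set.Ioc (0:ℝ) T,
      (L (traj x0 v t ω) (v t ω) + ϖ t ω * v t ω)) + Ψ (traj x0 v T ω)) ∂P

def lamH (T : ℝ) : Measure ℝ := volume.restrict (Set.Ioc (0:ℝ) T)

instance (T : ℝ) : IsFiniteMeasure (lamH T) := by unfold lamH; infer_instance

def muH {Ω : Type*} {m : MeasurableSpace Ω} (P : Measure Ω) (T : ℝ) : Measure (ℝ × Ω) :=
  (lamH T).prod P

instance {Ω : Type*} {m : MeasurableSpace Ω} (P : Measure Ω) [IsProbabilityMeasure P] (T : ℝ) :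
    IsFiniteMeasure (muH P T) := by unfold muH; infer_instance

def progSA {Ω : Type*} {m : MeasurableSpace Ω} (𝔽 : Filtration ℝ m) : MeasurableSpace (ℝ × Ω) :=
  ⨅ i : ℝ, MeasurableSpace.map (fun p : Set.Iic i × Ω => ((p.1 : ℝ), p.2))
    (Subtype.instMeasurableSpace.prod (𝔽 i))

lemma progSA_meas_iff {Ω : Type*} {m : MeasurableSpace Ω} (𝔽 : Filtration ℝ m) (A : Set (ℝ × Ω)) :
    MeasurableSet[progSA 𝔽] A ↔ ∀ i : ℝ, MeasurableSet[Subtype.instMeasurableSpace.prod (𝔽 i)]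
      ((fun p : Set.Iic i × Ω => ((p.1 : ℝ), p.2)) ⁻¹' A) := by
  unfold progSA
  rw [MeasurableSpace.measurableSet_iInf]
  rfl

lemma prog_iff {Ω : Type*} {m : MeasurableSpace Ω} (𝔽 : Filtration ℝ m) (v : ℝ → Ω → ℝ) :
    IsStronglyProgressive 𝔽 v ↔ StronglyMeasurable[progSA 𝔽] (Function.uncurry v) := by
  constructor
  · intro h
    refine Measurable.stronglyMeasurable (mα := progSA 𝔽) ?_
    intro s hs
    rw [progSA_meas_iff]
    intro i
    exact (h i).measurable hs
  · intro h i
    refine Measurable.stronglyMeasurable (mα := Subtype.instMeasurableSpace.prod (𝔽 i)) ?_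
    intro s hs
    exact (progSA_meas_iff 𝔽 _).1 (h.measurable hs) i

lemma progSA_le {Ω : Type*} {m : MeasurableSpace Ω} (𝔽 : Filtration ℝ m) :
    progSA 𝔽 ≤ (inferInstance : MeasurableSpace (ℝ × Ω)) := by
  intro A hA
  rw [progSA_meas_iff] at hA
  have : A = ⋃ n : ℕ, (A ∩ (Set.Iic (n:ℝ) ×ˢ Set.univ)) := by
    ext ⟨t, ω⟩
    simp only [Set.mem_iUnion, Set.mem_inter_iff, Set.mem_prod, Set.mem_Iic, Set.mem_univ, and_true]
    constructor
    · intro h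
      obtain ⟨n, hn⟩ := exists_nat_ge t
      exact ⟨n, h, hn⟩
    · rintro ⟨n, h, _⟩
      exact h
  rw [this]
  refine MeasurableSet.iUnion fun n => ?_
  have h1 : MeasurableSet ((fun p : Set.Iic (n:ℝ) × Ω => ((p.1 : ℝ), p.2)) ⁻¹' A) := by
    have hle : (Subtype.instMeasurableSpace.prod (𝔽 (n:ℝ)) : MeasurableSpace (Set.Iic (n:ℝ) × Ω)) ≤
        Subtype.instMeasurableSpace.prod m :=
      sup_le_sup le_rfl (MeasurableSpace.comap_mono (𝔽.le _))
    exact hle _ (hA n)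
  have he : MeasurableEmbedding (fun p : Set.Iic (n:ℝ) × Ω => ((p.1 : ℝ), p.2)) :=
    (MeasurableEmbedding.subtype_coe measurableSet_Iic).prodMap MeasurableEmbedding.id
  have h2 := he.measurableSet_image.2 h1
  convert h2 using 1
  ext ⟨t, ω⟩
  simp only [Set.mem_inter_iff, Set.mem_prod, Set.mem_Iic, Set.mem_univ, and_true, Set.mem_image,
    Set.mem_preimage, Prod.exists, Subtype.exists, Prod.mk.injEq]
  constructor
  · rintro ⟨h, h'⟩
    exact ⟨t, h', ω, h, rfl, rfl⟩
  · rintro ⟨a, ha, b, h, rfl, rfl⟩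
    exact ⟨h, ha⟩

lemma memH_iff {Ω : Type*} {m : MeasurableSpace Ω} (P : Measure Ω) [IsProbabilityMeasure P]
    (T : ℝ) (𝔽 : Filtration ℝ m) (v : ℝ → Ω → ℝ) :
    MemH P T 𝔽 v ↔ StronglyMeasurable[progSA 𝔽] (Function.uncurry v) ∧
      MemLp (Function.uncurry v) 2 (muH P T) := by
  have key : ∀ v : ℝ → Ω → ℝ, StronglyMeasurable[progSA 𝔽] (Function.uncurry v) →
     ((∫⁻ ω, (∫⁻ t in Set.Ioc (0:ℝ) T, ENNReal.ofReal ((v t ω) ^ 2)) ∂P) < ⊤ ↔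
       MemLp (Function.uncurry v) 2 (muH P T)) := by
    intro v hv
    have hm : Measurable (Function.uncurry v) := hv.measurable.mono (progSA_le 𝔽) le_rfl
    rw [memLp_two_iff_integrable_sq hm.aestronglyMeasurable]
    unfold Integrable
    rw [hasFiniteIntegral_iff_ofReal (Filter.Eventually.of_forall fun _ => sq_nonneg _)]
    unfold muH lamH
    rw [lintegral_prod_symm _ (by fun_prop)]
    have : AEStronglyMeasurable (fun a => Function.uncurry v a ^ 2)
      ((volume.restrict (Set.Ioc 0 T)).prod P) := by fun_prop
    simp only [this, true_and]
    rfl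
  constructor
  · rintro ⟨h1, h2⟩
    have h1' := (prog_iff 𝔽 v).1 h1
    exact ⟨h1', (key v h1').1 h2⟩
  · rintro ⟨h1, h2⟩
    exact ⟨(prog_iff 𝔽 v).2 h1, (key v h1).2 h2⟩

lemma innerH_eq {Ω : Type*} {m : MeasurableSpace Ω} (P : Measure Ω) [IsProbabilityMeasure P]
    (T : ℝ) (v w : ℝ → Ω → ℝ) (hv : MemLp (Function.uncurry v) 2 (muH P T))
    (hw : MemLp (Function.uncurry w) 2 (muH P T)) :
    innerH P T v w = ∫ z, Function.uncurry v z * Function.uncurry w z ∂(muH P T) := by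
  unfold innerH
  have : Integrable (fun z => Function.uncurry v z * Function.uncurry w z) (muH P T) :=
    hv.integrable_mul hw
  unfold muH at this ⊢
  rw [integral_prod_symm _ this]
  rfl

lemma exists_proj {Ω : Type*} {m : MeasurableSpace Ω} (P : Measure Ω) [IsProbabilityMeasure P]
    (T : ℝ) (𝔽 : Filtration ℝ m) (g : ℝ → Ω → ℝ) (hg : MemLp (Function.uncurry g) 2 (muH P T)) :
    ∃ w, MemH P T 𝔽 w ∧ ∀ u, MemH P T 𝔽 u → innerH P T u g = innerH P T u w := by
  set c := (muH P T)[Function.uncurry g | progSA 𝔽] with hc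
  have hcL : MemLp c 2 (muH P T) := hg.condExp (by norm_num)
  refine ⟨fun t ω => c (t, ω), (memH_iff P T 𝔽 _).2 ⟨stronglyMeasurable_condExp, hcL⟩, ?_⟩
  intro u hu
  obtain ⟨hu1, hu2⟩ := (memH_iff P T 𝔽 u).1 hu
  rw [innerH_eq P T u g hu2 hg, innerH_eq P T u (fun t ω => c (t, ω)) hu2 hcL]
  have h := condExp_mul_of_stronglyMeasurable_left (μ := muH P T) hu1 (hu2.integrable_mul hg)
    (hg.integrable (by norm_num))
  have h2 := integral_condExp (μ := muH P T) (progSA_le 𝔽) (f := Function.uncurry u * Function.uncurry g)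
  rw [integral_congr_ae h] at h2
  exact h2.symm

lemma weak_bdd {Ω : Type*} {m : MeasurableSpace Ω} (P : Measure Ω) [IsProbabilityMeasure P]
    (T : ℝ) (𝔽 : Filtration ℝ m) (vk : ℕ → ℝ → Ω → ℝ) (v : ℝ → Ω → ℝ)
    (hvk : ∀ k, MemH P T 𝔽 (vk k))
    (hweak : ∀ w, MemH P T 𝔽 w →
      Filter.Tendsto (fun k => innerH P T (vk k) w) Filter.atTop
        (nhds (innerH P T v w))) :
    ∃ M : ℝ, ∀ k, innerH P T (vk k) (vk k) ≤ M := by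
  have hS := fun k => ((memH_iff P T 𝔽 _).1 (hvk k)).1
  have hL := fun k => ((memH_iff P T 𝔽 _).1 (hvk k)).2
  let μ' := (muH P T).trim (progSA_le 𝔽)
  have hL' : ∀ k, MemLp (Function.uncurry (vk k)) 2 μ' := fun k =>
    ⟨(hS k).aestronglyMeasurable, by
      rw [eLpNorm_trim _ (hS k)]; exact (hL k).2⟩
  let V : ℕ → Lp ℝ 2 μ' := fun k => (hL' k).toLp
  have hin : ∀ k (f : Lp ℝ 2 μ'), inner ℝ (V k) f = innerH P T (vk k) (fun t ω => f (t, ω)) ∧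
      MemH P T 𝔽 (fun t ω => f (t, ω)) := by
    intro k f
    have hf1 : StronglyMeasurable[progSA 𝔽] f := Lp.stronglyMeasurable f
    have hf2 : MemLp f 2 (muH P T) := memLp_of_memLp_trim _ (Lp.memLp f)
    refine ⟨?_, (memH_iff P T 𝔽 _).2 ⟨hf1, hf2⟩⟩
    rw [innerH_eq P T _ (fun t ω => f (t, ω)) (hL k) hf2, L2.inner_def]
    have : (fun a => inner ℝ (V k a) (f a)) =ᵐ[μ'] fun z => Function.uncurry (vk k) z * f z := by
      filter_upwards [(hL' k).coeFn_toLp] with z hz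
      simp only [V, hz]
      simp [mul_comm]
    rw [integral_congr_ae this]
    exact (integral_trim (progSA_le 𝔽) ((hS k).mul hf1)).symm
  obtain ⟨C, hC⟩ := banach_steinhaus (g := fun k => innerSL ℝ (V k)) (by
    intro f
    have ht := hweak _ (hin 0 f).2
    obtain ⟨C, hC⟩ := (ht.norm).bddAbove_range
    refine ⟨C, fun k => ?_⟩
    have := hC ⟨k, rfl⟩
    simp only [innerSL_apply_apply]
    rw [(hin k f).1]
    exact this)
  refine ⟨C ^ 2, fun k => ?_⟩
  have h1 : innerH P T (vk k) (vk k) = inner ℝ (V k) (V k) := by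
    rw [(hin k (V k)).1, innerH_eq P T _ _ (hL k) (hL k), innerH_eq P T _ _ (hL k)
      ((memH_iff P T 𝔽 _).1 (hin k (V k)).2).2]
    refine integral_congr_ae ?_
    filter_upwards [ae_eq_of_ae_eq_trim (hL' k).coeFn_toLp] with z hz
    simp only [V, Function.uncurry] at hz ⊢
    rw [hz]
  rw [h1, real_inner_self_eq_norm_sq]
  have := hC k
  rw [innerSL_apply_norm] at this
  gcongr

lemma lam_prim {T : ℝ} (h : ℝ → ℝ) {t : ℝ} (ht : t ∈ Set.Icc 0 T) :
    ∫ s in (0:ℝ)..t, h s = ∫ s, (if s ≤ t then h s else 0) ∂(lamH T) := by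
  have h1 : (fun s => if s ≤ t then h s else 0) = (Set.Iic t).indicator h := by
    ext s; simp [Set.indicator_apply]
  rw [intervalIntegral.integral_of_le ht.1, h1, integral_indicator measurableSet_Iic]
  unfold lamH
  rw [Measure.restrict_restrict measurableSet_Iic]
  congr 2
  ext s
  simp only [Set.mem_Ioc, Set.mem_inter_iff, Set.mem_Iic]
  constructor
  · rintro ⟨h1, h2⟩; exact ⟨h2, h1, h2.trans ht.2⟩
  · rintro ⟨h1, h2, h3⟩; exact ⟨h2, h1⟩

lemma lam_ae {T : ℝ} : ∀ᵐ t ∂(lamH T), t ∈ Set.Ioc 0 T := by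
  unfold lamH
  exact ae_restrict_mem measurableSet_Ioc

lemma lam_swap {T : ℝ} (a h : ℝ → ℝ) (ha : Integrable a (lamH T)) (hh : Integrable h (lamH T)) :
    Integrable (fun t => a t * ∫ s in (0:ℝ)..t, h s) (lamH T) ∧
    Integrable (fun s => h s * ∫ t, (if s ≤ t then a t else 0) ∂(lamH T)) (lamH T) ∧
    ∫ t, (a t * ∫ s in (0:ℝ)..t, h s) ∂(lamH T) =
      ∫ s, (h s * ∫ t, (if s ≤ t then a t else 0) ∂(lamH T)) ∂(lamH T) := by
  have hi : Integrable (Function.uncurry fun t s : ℝ => if s ≤ t then a t * h s else 0)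
      ((lamH T).prod (lamH T)) := by
    have h0 : Integrable (fun z : ℝ × ℝ => a z.1 * h z.2) ((lamH T).prod (lamH T)) :=
      ha.mul_prod hh
    have h1 := h0.indicator (measurableSet_le measurable_snd measurable_fst :
      MeasurableSet {z : ℝ × ℝ | z.2 ≤ z.1})
    refine h1.congr (Filter.Eventually.of_forall ?_)
    rintro ⟨t, s⟩
    simp only [Function.uncurry, Set.indicator_apply, Set.mem_ofPred_eq]
  have e1 : (fun t => a t * ∫ s in (0:ℝ)..t, h s) =ᵐ[lamH T]
      fun t => ∫ s, (if s ≤ t then a t * h s else 0) ∂(lamH T) := by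
    filter_upwards [lam_ae] with t ht
    rw [lam_prim h ⟨ht.1.le, ht.2⟩, ← integral_const_mul]
    congr 1; ext s; split_ifs <;> simp
  have e2 : (fun s => h s * ∫ t, (if s ≤ t then a t else 0) ∂(lamH T)) =
      fun s => ∫ t, (if s ≤ t then a t * h s else 0) ∂(lamH T) := by
    ext s
    rw [← integral_const_mul]
    congr 1; ext t; split_ifs <;> simp [mul_comm]
  refine ⟨hi.integral_prod_left.congr e1.symm, ?_, ?_⟩
  · rw [e2]; exact hi.integral_prod_right
  · rw [integral_congr_ae e1, e2]
    exact integral_integral_swap hi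

lemma det_ineq {T x0 : ℝ} (hT : 0 < T) (u v w a b Fu Fv : ℝ → ℝ) (pu pv p : ℝ)
    (hu : MemLp u 2 (lamH T)) (hv : MemLp v 2 (lamH T)) (hw : MemLp w 2 (lamH T))
    (ha : MemLp a 2 (lamH T)) (hb : MemLp b 2 (lamH T))
    (hFu : Integrable Fu (lamH T)) (hFv : Integrable Fv (lamH T))
    (hF : ∀ t, Fv t + a t * ((x0 + ∫ s in (0:ℝ)..t, u s) - (x0 + ∫ s in (0:ℝ)..t, v s)) +
      b t * (u t - v t) + w t * (u t - v t) ≤ Fu t)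
    (hp : pv + p * ((x0 + ∫ s in (0:ℝ)..T, u s) - (x0 + ∫ s in (0:ℝ)..T, v s)) ≤ pu) :
    ((∫ t, Fv t ∂(lamH T)) + pv) + ∫ s, (u s - v s) *
      ((∫ t, (if s ≤ t then a t else 0) ∂(lamH T)) + b s + w s + p) ∂(lamH T)
      ≤ (∫ t, Fu t ∂(lamH T)) + pu := by
  have iu : Integrable u (lamH T) := hu.integrable (by norm_num)
  have iv : Integrable v (lamH T) := hv.integrable (by norm_num)
  have ia : Integrable a (lamH T) := ha.integrable (by norm_num)
  have hh : MemLp (fun t => u t - v t) 2 (lamH T) := hu.sub hv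
  have ih : Integrable (fun t => u t - v t) (lamH T) := iu.sub iv
  have hsub : ∀ t ∈ Set.Icc 0 T, (x0 + ∫ s in (0:ℝ)..t, u s) - (x0 + ∫ s in (0:ℝ)..t, v s) =
      ∫ s in (0:ℝ)..t, (u s - v s) := by
    intro t ht
    have hr : ∀ f : ℝ → ℝ, Integrable f (lamH T) → IntervalIntegrable f volume 0 t := by
      intro f hf
      rw [intervalIntegrable_iff_integrableOn_Ioc_of_le ht.1]
      exact IntegrableOn.mono_set (t := Set.Ioc 0 T) hf (Set.Ioc_subset_Ioc_right ht.2)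
    rw [intervalIntegral.integral_sub (hr u iu) (hr v iv)]
    ring
  obtain ⟨s1, s2, s3⟩ := lam_swap a _ ia ih
  have ib : Integrable (fun t => b t * (u t - v t)) (lamH T) := hb.integrable_mul hh
  have iw : Integrable (fun t => w t * (u t - v t)) (lamH T) := hw.integrable_mul hh
  have m1 : ∫ t, (Fv t + a t * (∫ s in (0:ℝ)..t, (u s - v s)) +
      b t * (u t - v t) + w t * (u t - v t)) ∂(lamH T) ≤ ∫ t, Fu t ∂(lamH T) := by
    refine integral_mono_ae (((hFv.add s1).add ib).add iw) hFu ?_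
    filter_upwards [lam_ae] with t ht
    have := hF t
    rwa [hsub t ⟨ht.1.le, ht.2⟩] at this
  have e1 : ∫ t, (Fv t + a t * (∫ s in (0:ℝ)..t, (u s - v s)) +
      b t * (u t - v t) + w t * (u t - v t)) ∂(lamH T) = ∫ t, Fv t ∂(lamH T) +
      ∫ t, (a t * (∫ s in (0:ℝ)..t, (u s - v s))) ∂(lamH T) +
      ∫ t, (b t * (u t - v t)) ∂(lamH T) + ∫ t, (w t * (u t - v t)) ∂(lamH T) := by
    have j1 : Integrable (fun t => Fv t + a t * (∫ s in (0:ℝ)..t, (u s - v s))) (lamH T) :=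
      hFv.add s1
    have j2 : Integrable (fun t => Fv t + a t * (∫ s in (0:ℝ)..t, (u s - v s)) +
      b t * (u t - v t)) (lamH T) := j1.add ib
    rw [integral_add j2 iw, integral_add j1 ib, integral_add hFv s1]
  have e2 : ∫ s, (u s - v s) *
      ((∫ t, (if s ≤ t then a t else 0) ∂(lamH T)) + b s + w s + p) ∂(lamH T) =
      ∫ s, ((u s - v s) * ∫ t, (if s ≤ t then a t else 0) ∂(lamH T)) ∂(lamH T) +
      ∫ t, (b t * (u t - v t)) ∂(lamH T) + ∫ t, (w t * (u t - v t)) ∂(lamH T) +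
      ∫ t, p * (u t - v t) ∂(lamH T) := by
    have j1 : Integrable (fun s => ((u s - v s) * ∫ t, (if s ≤ t then a t else 0) ∂(lamH T)) +
      b s * (u s - v s)) (lamH T) := s2.add ib
    have j2 : Integrable (fun s => ((u s - v s) * ∫ t, (if s ≤ t then a t else 0) ∂(lamH T)) +
      b s * (u s - v s) + w s * (u s - v s)) (lamH T) := j1.add iw
    rw [← integral_add s2 ib, ← integral_add j1 iw, ← integral_add j2 (ih.const_mul p)]
    congr 1; ext s; ring
  rw [hsub T ⟨hT.le, le_rfl⟩, intervalIntegral.integral_of_le hT.le] at hp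
  have e3 : ∫ t, p * (u t - v t) ∂(lamH T) = p * ∫ t in Set.Ioc 0 T, (u t - v t) := by
    rw [integral_const_mul]; rfl
  linarith

lemma lam_cs {T : ℝ} (hT : 0 < T) (u : ℝ → ℝ) (hu : MemLp u 2 (lamH T)) :
    (∫ t, |u t| ∂(lamH T)) ^ 2 ≤ T * ∫ t, (u t) ^ 2 ∂(lamH T) := by
  set N := ∫ t, |u t| ∂(lamH T) with hN
  have i2 : Integrable (fun t => u t ^ 2) (lamH T) := hu.integrable_sq
  have i1 : Integrable (fun t => |u t|) (lamH T) := (hu.integrable (by norm_num)).abs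
  have h0 : 0 ≤ ∫ t, (T * |u t| - N) ^ 2 ∂(lamH T) := integral_nonneg fun _ => sq_nonneg _
  have h1 : ∫ t, (T * |u t| - N) ^ 2 ∂(lamH T) =
      ∫ t, (T ^ 2 * (u t ^ 2) - (2 * T * N) * |u t| + N ^ 2) ∂(lamH T) := by
    congr 1; ext t; rw [← sq_abs (u t)]; ring
  have hc : ∫ _t : ℝ, N ^ 2 ∂(lamH T) = T * N ^ 2 := by
    unfold lamH
    simp [hT.le]
  have j1 : Integrable (fun t => T ^ 2 * (u t ^ 2) - (2 * T * N) * |u t|) (lamH T) :=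
    (i2.const_mul _).sub (i1.const_mul _)
  rw [h1, integral_add j1 (integrable_const _),
    integral_sub (i2.const_mul _) (i1.const_mul _), integral_const_mul, integral_const_mul, hc,
    ← hN] at h0
  have h2 : 0 ≤ T * (T * ∫ t, (u t) ^ 2 ∂(lamH T) - N ^ 2) := by nlinarith
  have := nonneg_of_mul_nonneg_right h2 hT
  linarith

lemma prim_le {T : ℝ} (u : ℝ → ℝ) (hT : 0 < T) :
    |∫ s in (0:ℝ)..T, u s| ≤ ∫ t, |u t| ∂(lamH T) := by
  rw [intervalIntegral.integral_of_le hT.le]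
  exact abs_integral_le_integral_abs

lemma traj_meas {Ω : Type*} {m : MeasurableSpace Ω} (x0 : ℝ) (u : ℝ → Ω → ℝ)
    (hu : Measurable (Function.uncurry u)) :
    Measurable (fun z : ℝ × Ω => traj x0 u z.1 z.2) := by
  have key : ∀ (S : Set (ℝ × ℝ)), MeasurableSet S →
      Measurable (fun z : ℝ × Ω => ∫ s, S.indicator (fun q => u q.2 z.2) (z.1, s)) := by
    intro S hS
    have h1 : Measurable (Function.uncurry fun (z : ℝ × Ω) (s : ℝ) =>
        S.indicator (fun q => u q.2 z.2) (z.1, s)) := by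
      have : (Function.uncurry fun (z : ℝ × Ω) (s : ℝ) =>
        S.indicator (fun q => u q.2 z.2) (z.1, s)) =
        ((fun y : (ℝ × Ω) × ℝ => (y.1.1, y.2)) ⁻¹' S).indicator
          (fun y => Function.uncurry u (y.2, y.1.2)) := by
        ext ⟨⟨t, ω⟩, s⟩
        rfl
      rw [this]
      refine Measurable.indicator (hu.comp (by fun_prop)) (hS.preimage (by fun_prop))
    exact (h1.stronglyMeasurable.integral_prod_right (ν := volume)).measurable
  have e : (fun z : ℝ × Ω => traj x0 u z.1 z.2) = fun z : ℝ × Ω => x0 +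
      ((∫ s, ({q : ℝ × ℝ | 0 < q.2 ∧ q.2 ≤ q.1}).indicator (fun q => u q.2 z.2) (z.1, s)) -
       (∫ s, ({q : ℝ × ℝ | q.1 < q.2 ∧ q.2 ≤ 0}).indicator (fun q => u q.2 z.2) (z.1, s))) := by
    ext ⟨t, ω⟩
    simp only [traj, intervalIntegral]
    rw [← integral_indicator measurableSet_Ioc, ← integral_indicator measurableSet_Ioc]
    rfl
  rw [e]
  refine measurable_const.add ((key _ ?_).sub (key _ ?_))
  · exact (measurableSet_lt measurable_const measurable_snd).inter
      (measurableSet_le measurable_snd measurable_fst)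
  · exact (measurableSet_lt measurable_fst measurable_snd).inter
      (measurableSet_le measurable_snd measurable_const)

lemma slice_ae {Ω : Type*} {m : MeasurableSpace Ω} (P : Measure Ω) [IsProbabilityMeasure P]
    (T : ℝ) (u : ℝ → Ω → ℝ) (hm : Measurable (Function.uncurry u))
    (hu : MemLp (Function.uncurry u) 2 (muH P T)) :
    ∀ᵐ ω ∂P, MemLp (fun t => u t ω) 2 (lamH T) := by
  have h1 : Integrable (fun z => Function.uncurry u z ^ 2) ((lamH T).prod P) := hu.integrable_sq
  filter_upwards [h1.prod_left_ae] with ω hω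
  rw [memLp_two_iff_integrable_sq]
  · exact hω
  · exact (hm.comp (g := Function.uncurry u) (f := fun t => (t, ω)) (by fun_prop)).aestronglyMeasurable

lemma S_int {Ω : Type*} {m : MeasurableSpace Ω} (P : Measure Ω) [IsProbabilityMeasure P]
    (T : ℝ) (u : ℝ → Ω → ℝ) (hu : MemLp (Function.uncurry u) 2 (muH P T)) :
    Integrable (fun ω => ∫ t, (u t ω) ^ 2 ∂(lamH T)) P := by
  have h1 : Integrable (fun z => Function.uncurry u z ^ 2) ((lamH T).prod P) := hu.integrable_sq
  exact h1.integral_prod_right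

lemma N_mem {Ω : Type*} {m : MeasurableSpace Ω} (P : Measure Ω) [IsProbabilityMeasure P]
    {T : ℝ} (hT : 0 < T) (u : ℝ → Ω → ℝ) (hm : Measurable (Function.uncurry u))
    (hu : MemLp (Function.uncurry u) 2 (muH P T)) :
    MemLp (fun ω => ∫ t, |u t ω| ∂(lamH T)) 2 P := by
  have hN : StronglyMeasurable (fun ω => ∫ t, |u t ω| ∂(lamH T)) := by
    refine StronglyMeasurable.integral_prod_left (f := fun t ω => |u t ω|) ?_
    exact (measurable_norm.comp hm).stronglyMeasurable
  rw [memLp_two_iff_integrable_sq hN.aestronglyMeasurable]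
  refine ((S_int P T u hu).const_mul T).mono' (hN.pow 2).aestronglyMeasurable ?_
  filter_upwards [slice_ae P T u hm hu] with ω hω
  rw [Real.norm_of_nonneg (sq_nonneg _)]
  exact lam_cs hT _ hω

lemma snd_mem {Ω : Type*} {m : MeasurableSpace Ω} (P : Measure Ω) [IsProbabilityMeasure P]
    {T : ℝ} (f : Ω → ℝ) (hf : MemLp f 2 P) : MemLp (fun z : ℝ × Ω => f z.2) 2 (muH P T) :=
  hf.comp_snd _

lemma grad_ineq {E : Type*} [NormedAddCommGroup E] [NormedSpace ℝ E] (f : E → ℝ)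
    (hf : ConvexOn ℝ Set.univ f) (f' : E →L[ℝ] ℝ) (x y : E) (h : HasFDerivAt f f' x) :
    f x + f' (y - x) ≤ f y := by
  have hc : ConvexOn ℝ Set.univ (f ∘ (AffineMap.lineMap x y : ℝ →ᵃ[ℝ] E)) :=
    hf.comp_affineMap _
  have hd : HasDerivAt (f ∘ (AffineMap.lineMap x y : ℝ →ᵃ[ℝ] E)) (f' (y - x)) 0 := by
    refine HasFDerivAt.comp_hasDerivAt (0:ℝ) ?_ AffineMap.hasDerivAt_lineMap
    simpa using h
  have := hc.le_slope_of_hasDerivAt (Set.mem_univ 0) (Set.mem_univ 1) one_pos hd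
  simp only [slope_def_field, Function.comp, AffineMap.lineMap_apply_one, AffineMap.lineMap_apply_zero,
    sub_zero, div_one] at this
  linarith

lemma cost_integrable {Ω : Type*} {m : MeasurableSpace Ω} (P : Measure Ω) [IsProbabilityMeasure P]
    {T : ℝ} (hT : 0 < T) (L : ℝ → ℝ → ℝ) (Ψ : ℝ → ℝ) (hL : Continuous (Function.uncurry L))
    (hL_nonneg : ∀ x v, 0 ≤ L x v) (hΨ : Continuous Ψ) (hΨ_nonneg : ∀ x, 0 ≤ Ψ x)
    (C : ℝ) (hC : 0 < C) (hΨ_growth : ∀ x, Ψ x ≤ C * (1 + |x| ^ 2))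
    (β : ℝ) (hβ : 0 < β) (hL_growth : ∀ x v, L x v ≤ β * (1 + |v| ^ 2))
    (x0 : ℝ) (w : ℝ → Ω → ℝ) (hwm : Measurable (Function.uncurry w))
    (hw : MemLp (Function.uncurry w) 2 (muH P T))
    (u : ℝ → Ω → ℝ) (hum : Measurable (Function.uncurry u))
    (hu : MemLp (Function.uncurry u) 2 (muH P T)) :
    Integrable (fun z : ℝ × Ω => L (traj x0 u z.1 z.2) (u z.1 z.2) + w z.1 z.2 * u z.1 z.2)
      ((lamH T).prod P) ∧ Integrable (fun ω => Ψ (traj x0 u T ω)) P ∧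
    Integrable (fun ω => ((∫ t, (L (traj x0 u t ω) (u t ω) + w t ω * u t ω) ∂(lamH T))
      + Ψ (traj x0 u T ω))) P ∧
    ∫ ω, ((∫ t, (L (traj x0 u t ω) (u t ω) + w t ω * u t ω) ∂(lamH T))
      + Ψ (traj x0 u T ω)) ∂P ≤ β * T + (β + 1 + 2 * C * T) * innerH P T u u + innerH P T w w
        + C * (1 + 2 * x0 ^ 2) := by
  have htm := traj_meas x0 u hum
  have i1 : Integrable (fun z : ℝ × Ω => L (traj x0 u z.1 z.2) (u z.1 z.2)) ((lamH T).prod P) := by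
    have hb : Integrable (fun z : ℝ × Ω => β * (1 + u z.1 z.2 ^ 2)) (muH P T) :=
      ((integrable_const 1).add hu.integrable_sq).const_mul β
    refine hb.mono' ?_ (Filter.Eventually.of_forall fun z => ?_)
    · exact (hL.measurable.comp (htm.prodMk hum)).aestronglyMeasurable
    · rw [Real.norm_of_nonneg (hL_nonneg _ _), ← sq_abs (u z.1 z.2)]
      exact hL_growth _ _
  have i2 : Integrable (fun z : ℝ × Ω => w z.1 z.2 * u z.1 z.2) ((lamH T).prod P) :=
    hw.integrable_mul hu
  have i3 := i1.add i2
  have hsu := S_int P T u hu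
  have hsw := S_int P T w hw
  have hTm : Measurable (fun ω => traj x0 u T ω) :=
    htm.comp (f := fun ω => (T, ω)) (by fun_prop)
  have hX : ∀ᵐ ω ∂P, Ψ (traj x0 u T ω) ≤
      C * (1 + 2 * x0 ^ 2) + 2 * C * T * ∫ t, (u t ω) ^ 2 ∂(lamH T) := by
    filter_upwards [slice_ae P T u hum hu] with ω hω
    refine (hΨ_growth _).trans ?_
    have h1 := lam_cs hT _ hω
    have h2 := prim_le (fun t => u t ω) hT
    have h3 : (∫ s in (0:ℝ)..T, u s ω) ^ 2 ≤ (∫ t, |u t ω| ∂(lamH T)) ^ 2 := by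
      rw [← sq_abs]; gcongr
    have h4 : |traj x0 u T ω| ^ 2 ≤ 2 * x0 ^ 2 + 2 * (∫ s in (0:ℝ)..T, u s ω) ^ 2 := by
      rw [sq_abs]; unfold traj
      nlinarith [sq_nonneg (x0 - ∫ s in (0:ℝ)..T, u s ω)]
    have h5 : |traj x0 u T ω| ^ 2 ≤ 2 * x0 ^ 2 + 2 * (T * ∫ t, (u t ω) ^ 2 ∂(lamH T)) := by
      linarith
    have := mul_le_mul_of_nonneg_left h5 hC.le
    linarith
  have i4 : Integrable (fun ω => Ψ (traj x0 u T ω)) P := by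
    have hb : Integrable (fun ω => C * (1 + 2 * x0 ^ 2) + 2 * C * T * ∫ t, (u t ω) ^ 2 ∂(lamH T)) P :=
      (integrable_const _).add (hsu.const_mul _)
    refine hb.mono' (hΨ.measurable.comp hTm).aestronglyMeasurable ?_
    filter_upwards [hX] with ω hω
    rwa [Real.norm_of_nonneg (hΨ_nonneg _)]
  have i5 : Integrable (fun ω => ((∫ t, (L (traj x0 u t ω) (u t ω) + w t ω * u t ω) ∂(lamH T))
      + Ψ (traj x0 u T ω))) P := i3.integral_prod_right.add i4
  refine ⟨i3, i4, i5, ?_⟩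
  have hb : Integrable (fun ω => (β * T + C * (1 + 2 * x0 ^ 2)) +
      ((β + 1 + 2 * C * T) * ∫ t, (u t ω) ^ 2 ∂(lamH T)) + ∫ t, (w t ω) ^ 2 ∂(lamH T)) P :=
    ((integrable_const _).add (hsu.const_mul _)).add hsw
  have hle := integral_mono_ae i5 hb (by
    filter_upwards [hX, slice_ae P T u hum hu, slice_ae P T w hwm hw, i3.prod_left_ae]
      with ω h1 h2 h3 h4
    have hI : ∫ t, (L (traj x0 u t ω) (u t ω) + w t ω * u t ω) ∂(lamH T) ≤
        ∫ t, (β + ((β + 1) * u t ω ^ 2) + w t ω ^ 2) ∂(lamH T) := by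
      refine integral_mono h4 (((integrable_const _).add
        (h2.integrable_sq.const_mul _)).add h3.integrable_sq) ?_
      intro t
      have := hL_growth (traj x0 u t ω) (u t ω)
      rw [sq_abs] at this
      simp only
      nlinarith [sq_nonneg (w t ω - u t ω), sq_nonneg (w t ω), sq_nonneg (u t ω)]
    have j1 : Integrable (fun t => (β + 1) * u t ω ^ 2) (lamH T) := h2.integrable_sq.const_mul _
    have j2 : Integrable (fun t => β + ((β + 1) * u t ω ^ 2)) (lamH T) :=
      (integrable_const _).add j1
    have hc : ∫ _t : ℝ, β ∂(lamH T) = T * β := by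
      unfold lamH
      simp [hT.le]
    rw [integral_add j2 h3.integrable_sq, integral_add (integrable_const _) j1,
      integral_const_mul, hc] at hI
    linarith)
  refine hle.trans (le_of_eq ?_)
  have k1 : Integrable (fun ω => (β + 1 + 2 * C * T) * ∫ t, (u t ω) ^ 2 ∂(lamH T)) P :=
    hsu.const_mul _
  have k2 : Integrable (fun ω => (β * T + C * (1 + 2 * x0 ^ 2)) +
      ((β + 1 + 2 * C * T) * ∫ t, (u t ω) ^ 2 ∂(lamH T))) P := (integrable_const _).add k1
  rw [integral_add k2 hsw, integral_add (integrable_const _) k1, integral_const_mul]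
  have e : ∀ f : ℝ → Ω → ℝ, innerH P T f f = ∫ ω, ∫ t, (f t ω) ^ 2 ∂(lamH T) ∂P := by
    intro f; simp only [innerH, lamH, pow_two]
  rw [e, e]
  simp
  ring

lemma exists_grad (L : ℝ → ℝ → ℝ) (hL_C1 : ContDiff ℝ 1 (Function.uncurry L))
    (hL_convex : ConvexOn ℝ Set.univ (Function.uncurry L)) (D : ℝ)
    (hLd : ∀ x v, |deriv (fun y => L y v) x| ≤ D * (1 + |v|) ∧
      |deriv (fun w => L x w) v| ≤ D * (1 + |v|)) :
    ∃ Lx Lv : ℝ × ℝ → ℝ, Continuous Lx ∧ Continuous Lv ∧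
      (∀ x y, |Lx (x, y)| ≤ D * (1 + |y|)) ∧ (∀ x y, |Lv (x, y)| ≤ D * (1 + |y|)) ∧
      ∀ x y x' y', L x y + Lx (x, y) * (x' - x) + Lv (x, y) * (y' - y) ≤ L x' y' := by
  have hLdiff : Differentiable ℝ (Function.uncurry L) := hL_C1.differentiable (by norm_num)
  have hfc : Continuous (fderiv ℝ (Function.uncurry L)) := hL_C1.continuous_fderiv (by norm_num)
  refine ⟨fun z => fderiv ℝ (Function.uncurry L) z (1, 0),
    fun z => fderiv ℝ (Function.uncurry L) z (0, 1), by fun_prop, by fun_prop, ?_, ?_, ?_⟩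
  · intro x y
    have h1 : HasDerivAt (fun y' : ℝ => (y', y)) ((1:ℝ), (0:ℝ)) x :=
      (hasDerivAt_id x).prodMk (hasDerivAt_const x y)
    have h2 := ((hLdiff (x, y)).hasFDerivAt.comp_hasDerivAt x h1).deriv
    have h3 := (hLd x y).1
    simp only [← h2]
    exact h3
  · intro x y
    have h1 : HasDerivAt (fun y' : ℝ => (x, y')) ((0:ℝ), (1:ℝ)) y :=
      (hasDerivAt_const y x).prodMk (hasDerivAt_id y)
    have h2 := ((hLdiff (x, y)).hasFDerivAt.comp_hasDerivAt y h1).deriv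
    have h3 := (hLd x y).2
    simp only [← h2]
    exact h3
  · intro x y x' y'
    have h := grad_ineq (Function.uncurry L) hL_convex _ (x, y) (x', y') (hLdiff (x, y)).hasFDerivAt
    have e : ((x', y') - (x, y) : ℝ × ℝ) = (x' - x) • ((1:ℝ), (0:ℝ)) + (y' - y) • ((0:ℝ), (1:ℝ)) := by
      simp
    rw [e, map_add, map_smul, map_smul] at h
    simp only [Function.uncurry, smul_eq_mul] at h
    simp only
    linarith

lemma K_mem {Ω : Type*} {m : MeasurableSpace Ω} (P : Measure Ω) [IsProbabilityMeasure P]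
    {T : ℝ} (K : ℝ × ℝ → ℝ) (hK : Continuous K) (D : ℝ)
    (hKb : ∀ x y, |K (x, y)| ≤ D * (1 + |y|)) (X v : ℝ → Ω → ℝ)
    (hX : Measurable (fun z : ℝ × Ω => X z.1 z.2))
    (hvm : Measurable (Function.uncurry v)) (hv : MemLp (Function.uncurry v) 2 (muH P T)) :
    Measurable (Function.uncurry fun t ω => K (X t ω, v t ω)) ∧
      MemLp (Function.uncurry fun t ω => K (X t ω, v t ω)) 2 (muH P T) := by
  have hm : Measurable (Function.uncurry fun t ω => K (X t ω, v t ω)) := by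
    have h0 : Measurable fun z : ℝ × Ω => (X z.1 z.2, Function.uncurry v z) := hX.prodMk hvm
    have h1 : Measurable fun z : ℝ × Ω => K (X z.1 z.2, Function.uncurry v z) :=
      hK.measurable.comp h0
    exact h1
  refine ⟨hm, ?_⟩
  have hdom : MemLp (fun z : ℝ × Ω => D * (1 + |Function.uncurry v z|)) 2 (muH P T) := by
    have h1 : MemLp (fun z : ℝ × Ω => |Function.uncurry v z|) 2 (muH P T) := hv.abs
    have h2 : MemLp (fun z : ℝ × Ω => 1 + |Function.uncurry v z|) 2 (muH P T) :=
      (memLp_const (1:ℝ)).add h1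
    exact h2.const_mul D
  refine hdom.mono' hm.aestronglyMeasurable (Filter.Eventually.of_forall fun z => ?_)
  exact hKb _ _

lemma p_mem {Ω : Type*} {m : MeasurableSpace Ω} (P : Measure Ω) [IsProbabilityMeasure P]
    {T : ℝ} (hT : 0 < T) (K : ℝ → ℝ) (hK : Continuous K) (D : ℝ) (hD : 0 < D)
    (hKb : ∀ x, |K x| ≤ D * (1 + |x|)) (x0 : ℝ) (v : ℝ → Ω → ℝ)
    (hvm : Measurable (Function.uncurry v)) (hv : MemLp (Function.uncurry v) 2 (muH P T)) :
    MemLp (fun ω => K (traj x0 v T ω)) 2 P := by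
  have hTm : Measurable (fun ω => traj x0 v T ω) :=
    (traj_meas x0 v hvm).comp (f := fun ω => (T, ω)) (by fun_prop)
  have hpm : Measurable (fun ω => K (traj x0 v T ω)) := hK.measurable.comp hTm
  have hd : MemLp (fun ω => D * (1 + (|x0| + ∫ t, |v t ω| ∂(lamH T)))) 2 P := by
    have h1 := N_mem P hT v hvm hv
    have h2 : MemLp (fun ω => |x0| + ∫ t, |v t ω| ∂(lamH T)) 2 P := (memLp_const |x0|).add h1
    have h3 : MemLp (fun ω => 1 + (|x0| + ∫ t, |v t ω| ∂(lamH T))) 2 P :=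
      (memLp_const (1:ℝ)).add h2
    exact h3.const_mul D
  refine hd.mono' hpm.aestronglyMeasurable (Filter.Eventually.of_forall fun ω => ?_)
  refine (hKb _).trans ?_
  have h2 := prim_le (fun t => v t ω) hT
  have h3 : |traj x0 v T ω| ≤ |x0| + ∫ t, |v t ω| ∂(lamH T) :=
    (abs_add_le _ _).trans (by gcongr)
  gcongr

lemma A_mem {Ω : Type*} {m : MeasurableSpace Ω} (P : Measure Ω) [IsProbabilityMeasure P]
    {T : ℝ} (hT : 0 < T) (a : ℝ → Ω → ℝ)
    (ham : Measurable (Function.uncurry a)) (hal : MemLp (Function.uncurry a) 2 (muH P T)) :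
    MemLp (Function.uncurry fun s ω => ∫ t, (if s ≤ t then a t ω else 0) ∂(lamH T)) 2
      (muH P T) := by
  have hAm : StronglyMeasurable
      (Function.uncurry fun s ω => ∫ t, (if s ≤ t then a t ω else 0) ∂(lamH T)) := by
    refine StronglyMeasurable.integral_prod_right
      (f := fun (z : ℝ × Ω) (t : ℝ) => if z.1 ≤ t then a t z.2 else 0) ?_
    refine Measurable.stronglyMeasurable ?_
    refine Measurable.ite (measurableSet_le (by fun_prop) (by fun_prop)) ?_ measurable_const
    exact ham.comp (f := fun y : (ℝ × Ω) × ℝ => (y.2, y.1.2)) (by fun_prop)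
  refine (snd_mem P _ (N_mem P hT a ham hal)).mono' hAm.aestronglyMeasurable ?_
  have : ∀ᵐ z ∂(muH P T), MemLp (fun t => a t z.2) 2 (lamH T) :=
    Measure.quasiMeasurePreserving_snd.ae (slice_ae P T a ham hal)
  filter_upwards [this] with z hz
  refine (norm_integral_le_integral_norm _).trans ?_
  refine integral_mono_of_nonneg (Filter.Eventually.of_forall fun _ => norm_nonneg _)
    (hz.integrable (by norm_num)).abs (Filter.Eventually.of_forall fun t => ?_)
  simp only
  split_ifs <;> simp

theorem cost_weakly_lower_semicontinuous
    {Ω : Type*} {m : MeasurableSpace Ω} (P : Measure Ω) [IsProbabilityMeasure P]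
    (T : ℝ) (hT : 0 < T) (𝔽 : Filtration ℝ m)
    (L : ℝ → ℝ → ℝ) (Ψ : ℝ → ℝ)
    -- (A1): L ∈ C¹, nonnegative, jointly convex
    (hL_C1 : ContDiff ℝ 1 (Function.uncurry L))
    (hL_nonneg : ∀ x v, 0 ≤ L x v)
    (hL_convex : ConvexOn ℝ Set.univ (Function.uncurry L))
    -- (A2): Ψ ∈ C¹, nonnegative, convex
    (hΨ_C1 : ContDiff ℝ 1 Ψ)
    (hΨ_nonneg : ∀ x, 0 ≤ Ψ x)
    (hΨ_convex : ConvexOn ℝ Set.univ Ψ)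
    -- (A3): growth of Ψ and Ψ'
    (hΨ_growth : ∃ C > (0:ℝ), ∀ x, Ψ x ≤ C * (1 + |x| ^ 2))
    (hΨ'_growth : ∃ C > (0:ℝ), ∀ x, |deriv Ψ x| ≤ C * (1 + |x|))
    -- (A4): growth of L, L_x, L_v
    (hL_growth : ∃ β > (0:ℝ), ∀ x v, L x v ≤ β * (1 + |v| ^ 2))
    (hL_deriv_growth : ∃ C > (0:ℝ), ∀ x v,
      |deriv (fun y => L y v) x| ≤ C * (1 + |v|) ∧
      |deriv (fun w => L x w) v| ≤ C * (1 + |v|))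
    (x0 : ℝ) (ϖ : ℝ → Ω → ℝ) (hϖ : MemH P T 𝔽 ϖ)
    (vk : ℕ → ℝ → Ω → ℝ) (v : ℝ → Ω → ℝ)
    (hvk : ∀ k, MemH P T 𝔽 (vk k)) (hv : MemH P T 𝔽 v)
    -- weak convergence: ⟨vᵏ, w⟩ → ⟨v, w⟩ for all w ∈ H_𝔽
    (hweak : ∀ w, MemH P T 𝔽 w →
      Filter.Tendsto (fun k => innerH P T (vk k) w) Filter.atTop
        (nhds (innerH P T v w))) :
    cost P T L Ψ ϖ x0 v ≤
      Filter.liminf (fun k => cost P T L Ψ ϖ x0 (vk k)) Filter.atTop := by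
  obtain ⟨C, hC, hΨg⟩ := hΨ_growth
  obtain ⟨C', hC', hΨ'g⟩ := hΨ'_growth
  obtain ⟨β, hβ, hLg⟩ := hL_growth
  obtain ⟨D, hD, hLd⟩ := hL_deriv_growth
  have meas : ∀ u, MemH P T 𝔽 u → Measurable (Function.uncurry u) := fun u hu =>
    ((memH_iff P T 𝔽 u).1 hu).1.measurable.mono (progSA_le 𝔽) le_rfl
  have mem : ∀ u, MemH P T 𝔽 u → MemLp (Function.uncurry u) 2 (muH P T) := fun u hu =>
    ((memH_iff P T 𝔽 u).1 hu).2
  have hϖm := meas _ hϖ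
  have hvm := meas _ hv
  have hcost : ∀ u, MemH P T 𝔽 u → _ := fun u hu =>
    cost_integrable P hT L Ψ hL_C1.continuous hL_nonneg hΨ_C1.continuous hΨ_nonneg C hC hΨg β hβ
      hLg x0 ϖ hϖm (mem _ hϖ) u (meas u hu) (mem u hu)
  -- upper bound
  obtain ⟨M, hM⟩ := weak_bdd P T 𝔽 vk v hvk hweak
  have hub : ∀ k, cost P T L Ψ ϖ x0 (vk k) ≤ β * T + (β + 1 + 2 * C * T) * M + innerH P T ϖ ϖ
        + C * (1 + 2 * x0 ^ 2) := by
    intro k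
    refine (hcost _ (hvk k)).2.2.2.trans ?_
    have : (β + 1 + 2 * C * T) * innerH P T (vk k) (vk k) ≤ (β + 1 + 2 * C * T) * M :=
      mul_le_mul_of_nonneg_left (hM k) (by positivity)
    linarith
  -- gradient
  have hΨdiff : Differentiable ℝ Ψ := hΨ_C1.differentiable (by norm_num)
  obtain ⟨Lx, Lv, hLxc, hLvc, hLxb, hLvb, hLgrad⟩ := exists_grad L hL_C1 hL_convex D hLd
  have hΨgrad : ∀ x x', Ψ x + deriv Ψ x * (x' - x) ≤ Ψ x' := by
    intro x x'
    have h := grad_ineq Ψ hΨ_convex _ x x' (hΨdiff x).hasDerivAt.hasFDerivAt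
    simp at h
    linarith
  have htm := traj_meas x0 v hvm
  obtain ⟨ham, hal⟩ := K_mem P Lx hLxc D hLxb (traj x0 v) v htm hvm (mem _ hv)
  obtain ⟨hbm, hbl⟩ := K_mem P Lv hLvc D hLvb (traj x0 v) v htm hvm (mem _ hv)
  have hpl := p_mem P hT _ (hΨ_C1.continuous_deriv (by norm_num)) C' hC' hΨ'g x0 v hvm (mem _ hv)
  obtain ⟨a, ha⟩ : ∃ a : ℝ → Ω → ℝ, a = fun t ω => Lx (traj x0 v t ω, v t ω) := ⟨_, rfl⟩
  obtain ⟨b, hb⟩ : ∃ b : ℝ → Ω → ℝ, b = fun t ω => Lv (traj x0 v t ω, v t ω) := ⟨_, rfl⟩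
  obtain ⟨p, hp⟩ : ∃ p : Ω → ℝ, p = fun ω => deriv Ψ (traj x0 v T ω) := ⟨_, rfl⟩
  rw [← ha] at ham hal
  rw [← hb] at hbm hbl
  rw [← hp] at hpl
  have hAl := A_mem P hT a ham hal
  obtain ⟨g, hg⟩ : ∃ g : ℝ → Ω → ℝ, g = fun s ω =>
    (∫ t, (if s ≤ t then a t ω else 0) ∂(lamH T)) + b s ω + ϖ s ω + p ω := ⟨_, rfl⟩
  have hgl : MemLp (Function.uncurry g) 2 (muH P T) := by
    rw [hg]
    exact ((hAl.add hbl).add (mem _ hϖ)).add (snd_mem P p hpl)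
  obtain ⟨w, hw, hgw⟩ := exists_proj P T 𝔽 g hgl
  -- lower bound
  have hlow : ∀ u, MemH P T 𝔽 u → cost P T L Ψ ϖ x0 v + (innerH P T u g - innerH P T v g) ≤
      cost P T L Ψ ϖ x0 u := by
    intro u hu
    have iu : Integrable (fun z : ℝ × Ω => u z.1 z.2 * g z.1 z.2) ((lamH T).prod P) :=
      (mem _ hu).integrable_mul hgl
    have iv : Integrable (fun z : ℝ × Ω => v z.1 z.2 * g z.1 z.2) ((lamH T).prod P) :=
      (mem _ hv).integrable_mul hgl
    have e1 : innerH P T u g - innerH P T v g =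
        ∫ ω, ∫ t, (u t ω - v t ω) * g t ω ∂(lamH T) ∂P := by
      rw [show innerH P T u g = ∫ ω, ∫ t, u t ω * g t ω ∂(lamH T) ∂P from rfl,
        show innerH P T v g = ∫ ω, ∫ t, v t ω * g t ω ∂(lamH T) ∂P from rfl,
        ← integral_sub iu.integral_prod_right iv.integral_prod_right]
      refine integral_congr_ae ?_
      filter_upwards [iu.prod_left_ae, iv.prod_left_ae] with ω h1 h2
      rw [← integral_sub h1 h2]
      congr 1; ext t; ring
    have id : Integrable (fun ω => ∫ t, (u t ω - v t ω) * g t ω ∂(lamH T)) P := by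
      have : Integrable (fun z : ℝ × Ω => (u z.1 z.2 - v z.1 z.2) * g z.1 z.2)
          ((lamH T).prod P) := ((mem _ hu).sub (mem _ hv)).integrable_mul hgl
      exact this.integral_prod_right
    obtain ⟨cu1, cu2, cu3, -⟩ := hcost u hu
    obtain ⟨cv1, cv2, cv3, -⟩ := hcost v hv
    rw [e1, show cost P T L Ψ ϖ x0 v = ∫ ω, ((∫ t, (L (traj x0 v t ω) (v t ω) + ϖ t ω * v t ω)
      ∂(lamH T)) + Ψ (traj x0 v T ω)) ∂P from rfl, ← integral_add cv3 id]
    refine integral_mono_ae (cv3.add id) cu3 ?_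
    filter_upwards [slice_ae P T u (meas _ hu) (mem _ hu), slice_ae P T v hvm (mem _ hv),
      slice_ae P T ϖ hϖm (mem _ hϖ), slice_ae P T a ham hal, slice_ae P T b hbm hbl,
      cu1.prod_left_ae, cv1.prod_left_ae] with ω h1 h2 h3 h4 h5 h6 h7
    simp only [hg]
    refine det_ineq hT (x0 := x0) (fun t => u t ω) (fun t => v t ω) (fun t => ϖ t ω)
      (fun t => a t ω) (fun t => b t ω) _ _ (Ψ (traj x0 u T ω)) (Ψ (traj x0 v T ω)) (p ω)
      h1 h2 h3 h4 h5 h6 h7 ?_ ?_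
    · intro t
      have := hLgrad (traj x0 v t ω) (v t ω) (traj x0 u t ω) (u t ω)
      simp only [traj, ha, hb] at this ⊢
      linarith
    · rw [hp]; exact hΨgrad _ _
  have hlim : Filter.Tendsto (fun k => cost P T L Ψ ϖ x0 v +
      (innerH P T (vk k) g - innerH P T v g)) Filter.atTop (nhds (cost P T L Ψ ϖ x0 v)) := by
    have h1 := ((hweak w hw).sub_const (innerH P T v w)).const_add (cost P T L Ψ ϖ x0 v)
    rw [sub_self, add_zero] at h1
    refine h1.congr fun k => ?_
    rw [hgw _ (hvk k), hgw _ hv]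
  rw [← hlim.liminf_eq]
  refine Filter.liminf_le_liminf (Filter.Eventually.of_forall fun k => hlow _ (hvk k)) hlim.isBoundedUnder_ge ?_
  exact Filter.IsBoundedUnder.isCoboundedUnder_ge
    ⟨_, Filter.eventually_map.2 (Filter.Eventually.of_forall hub)⟩
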